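/- arXiv:2605.21828 — 2 statements merged into one kernel-verified Lean document; each statement's English description precedes it below -/
import Mathlib

section
/- (Chebyshev expansion of the Bessel function on an interval.) Let k be a nonnegative integer, let 0 ≤ a < b and r > 0 be reals, and let ρ ∈ [a, b]. Then J_k(ρr) = c_{k0}(r)/2 + Σ_{ℓ=1}^∞ c_{kℓ}(r) · T_ℓ( 2(ρ−a)/(b−a) − 1 ), where for each ℓ ≥ 0 the coefficient is c_{kℓ}(r) = Σ_{q=0}^∞ c_{kℓ}^{p(q)}(r) with p(q) = 2q when ℓ is even and p(q) = 2q+1 when ℓ is odd, and where for a nonnegative integer p of the same parity as ℓ, c_{kℓ}^{p}(r) := 2 η_p · J_{(p+ℓ)/2}( (b−a)r/4 ) · J_{(p−ℓ)/2}( (b−a)r/4 ) · [ J_{k−p}( (b+a)r/2 ) + (−1)^p J_{k+p}( (b+a)r/2 ) ], with η_0 := 1/2 and η_p := 1 for p ≠ 0; both the series over q defining each c_{kℓ}(r) and the series over ℓ converge. -/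
/-- The Bessel function of the first kind of nonnegative integer order `n`,
defined by its everywhere-convergent power series. -/
noncomputable def besselJNat (n : ℕ) (x : ℝ) : ℝ :=
  ∑' q : ℕ, (-1 : ℝ) ^ q * (x / 2) ^ (2 * q + n) /
    ((q.factorial : ℝ) * ((q + n).factorial : ℝ))

/-- The Bessel function of the first kind of integer order. -/
noncomputable def besselJ (n : ℤ) (x : ℝ) : ℝ :=
  if 0 ≤ n then besselJNat n.toNat x else (-1 : ℝ) ^ n * besselJNat (-n).toNat x

/-- The term `c_{kℓ}^{p}(r)` appearing in the Chebyshev expansion of `J_k(ρ r)`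
for `ρ ∈ [a, b]`. -/
noncomputable def cklp (a b r : ℝ) (k ℓ : ℕ) (p : ℕ) : ℝ :=
  2 * (if p = 0 then (1 : ℝ) / 2 else 1) *
    besselJ (((p : ℤ) + (ℓ : ℤ)) / 2) ((b - a) * r / 4) *
    besselJ (((p : ℤ) - (ℓ : ℤ)) / 2) ((b - a) * r / 4) *
    (besselJ ((k : ℤ) - (p : ℤ)) ((b + a) * r / 2) +
      (-1 : ℝ) ^ p * besselJ ((k : ℤ) + (p : ℤ)) ((b + a) * r / 2))

/-- The Chebyshev coefficient `c_{kℓ}(r)`, given by a series over `q` of the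
terms `c_{kℓ}^{p(q)}(r)` with `p(q) = 2q` for even `ℓ` and `p(q) = 2q + 1` for odd `ℓ`. -/
noncomputable def ckl (a b r : ℝ) (k ℓ : ℕ) : ℝ :=
  ∑' q : ℕ, cklp a b r k ℓ (if Even ℓ then 2 * q else 2 * q + 1)


/-- Reindexing of pairs of naturals by difference and minimum. -/
def diffEquiv : ℤ × ℕ ≃ ℕ × ℕ where
  toFun p := (p.2 + p.1.toNat, p.2 + (-p.1).toNat)
  invFun p := ((p.1 : ℤ) - p.2, min p.1 p.2)
  left_inv := by
    rintro ⟨n, q⟩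
    simp only [Prod.mk.injEq]
    constructor <;> omega
  right_inv := by
    rintro ⟨n, q⟩
    simp only [Prod.mk.injEq]
    constructor <;> omega

lemma besselJ_neg (n : ℤ) (x : ℝ) : besselJ (-n) x = (-1 : ℝ) ^ n * besselJ n x := by
  have h1 : ((-1 : ℝ) ^ n) * (-1 : ℝ) ^ n = 1 := by
    rw [← zpow_add₀ (by norm_num)]
    exact Even.neg_one_zpow ⟨n, rfl⟩
  rcases lt_trichotomy n 0 with h | h | h
  · unfold besselJ
    rw [if_pos (by omega), if_neg (by omega), ← mul_assoc, h1, one_mul]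
  · subst h; simp
  · unfold besselJ
    rw [if_neg (by omega), if_pos (by omega), neg_neg, zpow_neg]
    congr 1
    exact inv_eq_of_mul_eq_one_left h1

/-- Terms of the double series. -/
noncomputable def bterm (x : ℝ) (p : ℕ × ℕ) : ℝ :=
  (x / 2) ^ p.1 / (p.1.factorial : ℝ) * ((-(x / 2)) ^ p.2 / (p.2.factorial : ℝ))

lemma tsum_bterm (x : ℝ) (n : ℤ) : ∑' q : ℕ, bterm x (diffEquiv (n, q)) = besselJ n x := by
  unfold besselJ
  split_ifs with h
  · unfold besselJNat
    refine tsum_congr fun q => ?_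
    have h2 : (-n).toNat = 0 := by omega
    simp only [bterm, diffEquiv, Equiv.coe_fn_mk, h2, add_zero]
    rw [neg_pow]
    have : (x / 2) ^ (2 * q + n.toNat) = (x / 2) ^ (q + n.toNat) * (x / 2) ^ q := by ring
    rw [this]
    field_simp
  · unfold besselJNat
    rw [← tsum_mul_left]
    refine tsum_congr fun q => ?_
    obtain ⟨m, rfl⟩ : ∃ m : ℕ, n = -(m : ℤ) := ⟨(-n).toNat, by omega⟩
    have h2 : (-(m : ℤ)).toNat = 0 := by omega
    have h3 : (- -(m : ℤ)).toNat = m := by omega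
    have h4 : (-1 : ℝ) ^ (-(m : ℤ)) = (-1) ^ m := by
      rw [zpow_neg, zpow_natCast, ← inv_pow]; norm_num
    simp only [bterm, diffEquiv, Equiv.coe_fn_mk, h2, h3, h4, add_zero]
    rw [neg_pow]
    have : (x / 2) ^ (2 * q + m) = (x / 2) ^ (q + m) * (x / 2) ^ q := by ring
    rw [this, pow_add (-1 : ℝ)]
    field_simp

lemma summable_bterm (x : ℝ) : Summable (fun p => ‖bterm x p‖) := by
  have := Summable.mul_norm (f := fun n : ℕ => (x / 2) ^ n / (n.factorial : ℝ))
    (g := fun n : ℕ => (-(x / 2)) ^ n / (n.factorial : ℝ))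
    (Real.summable_pow_div_factorial (x / 2)).norm
    (Real.summable_pow_div_factorial (-(x / 2))).norm
  exact this

lemma summable_bterm' (x : ℝ) : Summable (fun p : ℤ × ℕ => ‖bterm x (diffEquiv p)‖) :=
  (diffEquiv.summable_iff (f := fun p => ‖bterm x p‖)).2 (summable_bterm x)

lemma hasSum_fiber (x : ℝ) (n : ℤ) :
    HasSum (fun q : ℕ => bterm x (diffEquiv (n, q))) (besselJ n x) := by
  rw [← tsum_bterm]
  exact ((summable_bterm' x).of_norm.prod_factor n).hasSum

lemma summable_besselJ (x : ℝ) : Summable (fun n : ℤ => ‖besselJ n x‖) := by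
  refine Summable.of_nonneg_of_le (fun _ => norm_nonneg _) (fun n => ?_) (summable_bterm' x).prod
  rw [← tsum_bterm]
  exact norm_tsum_le_tsum_norm ((summable_bterm' x).prod_factor n)

lemma genfun (x : ℝ) (t : ℂ) (ht : t ≠ 0) :
    HasSum (fun n : ℤ => (besselJ n x : ℂ) * t ^ n) (Complex.exp (x / 2 * (t - t⁻¹))) := by
  have key : HasSum (fun p : ℕ × ℕ => (bterm x p : ℂ) * t ^ ((p.1 : ℤ) - p.2))
      (Complex.exp (x / 2 * (t - t⁻¹))) := by
    have e1 := NormedSpace.expSeries_div_hasSum_exp ((x / 2 : ℂ) * t)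
    have e2 := NormedSpace.expSeries_div_hasSum_exp (-(x / 2 : ℂ) * t⁻¹)
    have e3 := summable_mul_of_summable_norm
      (f := fun n : ℕ => ((x / 2 : ℂ) * t) ^ n / (n.factorial : ℂ))
      (g := fun n : ℕ => (-(x / 2 : ℂ) * t⁻¹) ^ n / (n.factorial : ℂ))
      (NormedSpace.norm_expSeries_div_summable _) (NormedSpace.norm_expSeries_div_summable _)
    have := e1.mul e2 e3
    rw [← Complex.exp_eq_exp_ℂ, ← Complex.exp_add] at this
    convert! this using 1
    · funext p
      simp only [bterm]
      push_cast
      rw [zpow_sub₀ ht, zpow_natCast, zpow_natCast, mul_pow, mul_pow, inv_pow]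
      field_simp
    · congr 1; ring
  have key2 := (diffEquiv.hasSum_iff).2 key
  refine key2.prod_fiberwise (fun n => ?_)
  have h := (Complex.hasSum_ofReal.2 (hasSum_fiber x n)).mul_right (t ^ n)
  convert! h using 1
  funext q
  simp only [Function.comp]
  congr 2
  simp only [diffEquiv, Equiv.coe_fn_mk]
  push_cast
  omega

/-- The exponential `e^{iθ}`. -/
noncomputable def ee (θ : ℝ) : ℂ := Complex.exp (θ * Complex.I)

lemma ee_ne (θ : ℝ) : ee θ ≠ 0 := Complex.exp_ne_zero _

lemma ee_norm (θ : ℝ) : ‖ee θ‖ = 1 := Complex.norm_exp_ofReal_mul_I θ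

lemma ee_cont : Continuous ee := by unfold ee; fun_prop

lemma ee_add (x y : ℝ) : ee (x + y) = ee x * ee y := by
  unfold ee; rw [← Complex.exp_add]; congr 1; push_cast; ring

lemma ee_zpow (θ : ℝ) (n : ℤ) : ee θ ^ n = ee (n * θ) := by
  unfold ee; rw [← Complex.exp_int_mul]; congr 1; push_cast; ring

lemma genfun' (x θ : ℝ) :
    HasSum (fun n : ℤ => (besselJ n x : ℂ) * ee (n * θ)) (ee (x * Real.sin θ)) := by
  have h := genfun x (ee θ) (ee_ne θ)
  simp only [ee_zpow] at h
  convert! h using 1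
  unfold ee
  rw [← Complex.exp_neg]
  congr 1
  push_cast
  rw [Complex.sin]
  rw [neg_mul]
  ring_nf
  simp only [Complex.I_sq]
  ring_nf

lemma integral_ee (n : ℤ) :
    ∫ θ in (0 : ℝ)..(2 * Real.pi), ee (n * θ) = if n = 0 then (2 * Real.pi : ℂ) else 0 := by
  split_ifs with h
  · subst h; simp [ee]
  · have hc : (n : ℂ) * Complex.I ≠ 0 := by
      simp [h]
    have := integral_exp_mul_complex (a := 0) (b := 2 * Real.pi) hc
    have h2 : ∀ θ : ℝ, ee (n * θ) = Complex.exp (n * Complex.I * θ) := by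
      intro θ; unfold ee; congr 1; push_cast; ring
    simp only [h2, this]
    have h3 : Complex.exp (n * Complex.I * (2 * Real.pi : ℝ)) = 1 := by
      rw [Complex.exp_eq_one_iff]; exact ⟨n, by push_cast; ring⟩
    rw [h3]; simp

lemma hasSum_int {ι : Type*} [Countable ι] (c : ι → ℂ) (hc : Summable (fun i => ‖c i‖))
    (m : ι → ℤ) (F G : ℝ → ℂ) (hG : Continuous G) (hG1 : ∀ θ, ‖G θ‖ ≤ 1)
    (hF : ∀ θ, HasSum (fun i => c i * ee (m i * θ)) (F θ)) :
    HasSum (fun i => c i * ∫ θ in (0 : ℝ)..(2 * Real.pi), ee (m i * θ) * G θ)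
      (∫ θ in (0 : ℝ)..(2 * Real.pi), F θ * G θ) := by
  have := intervalIntegral.hasSum_integral_of_dominated_convergence
    (μ := MeasureTheory.volume) (a := 0) (b := 2 * Real.pi)
    (F := fun i θ => c i * (ee (m i * θ) * G θ)) (f := fun θ => F θ * G θ)
    (fun i _ => ‖c i‖)
    (fun i => by
      have := ee_cont
      exact Continuous.aestronglyMeasurable (by fun_prop))
    (fun i => Filter.Eventually.of_forall fun θ _ => by
      rw [norm_mul, norm_mul, ee_norm, one_mul]
      exact mul_le_of_le_one_right (norm_nonneg _) (hG1 θ))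
    (Filter.Eventually.of_forall fun θ _ => hc)
    intervalIntegrable_const
    (Filter.Eventually.of_forall fun θ _ => by
      have := (hF θ).mul_right (G θ)
      simpa only [mul_assoc] using this)
  simpa only [intervalIntegral.integral_const_mul] using this

lemma bessel_integral (n : ℤ) (x : ℝ) :
    ∫ θ in (0 : ℝ)..(2 * Real.pi), ee (x * Real.sin θ) * ee (-n * θ)
      = 2 * Real.pi * besselJ n x := by
  have h := hasSum_int (fun n : ℤ => (besselJ n x : ℂ))
    (by simpa using summable_besselJ x) (fun n => n) (fun θ => ee (x * Real.sin θ))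
    (fun θ => ee (-n * θ)) (by have := ee_cont; fun_prop) (fun θ => (ee_norm _).le)
    (fun θ => genfun' x θ)
  refine h.unique ?_
  have h2 : ∀ i : ℤ, ∫ θ in (0 : ℝ)..(2 * Real.pi), ee (i * θ) * ee (-n * θ)
      = if i = n then (2 * Real.pi : ℂ) else 0 := by
    intro i
    have := integral_ee (i - n)
    simp only [sub_eq_zero] at this
    rw [← this]
    congr 1; funext θ
    rw [← ee_add]; congr 1; push_cast; ring
  simp only [h2]
  convert! hasSum_ite_eq n (2 * Real.pi * besselJ n x : ℂ) using 1
  funext i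
  split_ifs with hi
  · subst hi; ring
  · simp

lemma main_complex (k : ℤ) (A z τ : ℝ) :
    HasSum (fun p : ℤ × ℤ => (besselJ p.1 z : ℂ) * besselJ p.2 z * ee ((p.1 - p.2) * τ)
        * besselJ (k - p.1 - p.2) A) (besselJ k (A + 2 * z * Real.cos τ) : ℂ) := by
  have hs := Summable.mul_norm (f := fun n : ℤ => besselJ n z)
    (g := fun n : ℤ => besselJ n z) (summable_besselJ z) (summable_besselJ z)
  have h := hasSum_int
    (fun p : ℤ × ℤ => (besselJ p.1 z : ℂ) * besselJ p.2 z * ee ((p.1 - p.2) * τ))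
    (by
      convert! hs using 1
      funext p
      simp [ee_norm])
    (fun p => p.1 + p.2) (fun θ => ee (2 * z * Real.cos τ * Real.sin θ))
    (fun θ => ee (A * Real.sin θ) * ee (-k * θ)) (by have := ee_cont; fun_prop)
    (fun θ => by rw [norm_mul, ee_norm, ee_norm, one_mul])
    (fun θ => by
      have g1 := genfun' z (θ + τ)
      have g2 := genfun' z (θ - τ)
      have g3 := summable_mul_of_summable_norm
        (f := fun n : ℤ => (besselJ n z : ℂ) * ee (n * (θ + τ)))
        (g := fun n : ℤ => (besselJ n z : ℂ) * ee (n * (θ - τ)))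
        (by simpa [ee_norm] using summable_besselJ z)
        (by simpa [ee_norm] using summable_besselJ z)
      have g := g1.mul g2 g3
      rw [← ee_add] at g
      convert! g using 1
      · funext p
        have : ee ((p.1 - p.2) * τ) * ee ((p.1 + p.2 : ℤ) * θ)
            = ee (p.1 * (θ + τ)) * ee (p.2 * (θ - τ)) := by
          rw [← ee_add, ← ee_add]; congr 1; push_cast; ring
        linear_combination ((besselJ p.1 z : ℂ) * besselJ p.2 z) * this
      · congr 1
        rw [Real.sin_add, Real.sin_sub]; ring)
  have hpi : (2 * Real.pi : ℂ) ≠ 0 := by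
    simp [Real.pi_ne_zero]
  have h3 : ∀ p : ℤ × ℤ, ∫ θ in (0 : ℝ)..(2 * Real.pi), ee ((p.1 + p.2 : ℤ) * θ) *
      (ee (A * Real.sin θ) * ee (-k * θ)) = 2 * Real.pi * besselJ (k - p.1 - p.2) A := by
    intro p
    rw [← bessel_integral]
    congr 1; funext θ
    rw [← ee_add, ← ee_add, ← ee_add]; congr 1; push_cast; ring
  have h4 : ∫ θ in (0 : ℝ)..(2 * Real.pi), ee (2 * z * Real.cos τ * Real.sin θ) *
      (ee (A * Real.sin θ) * ee (-k * θ)) = 2 * Real.pi * besselJ k (A + 2 * z * Real.cos τ) := by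
    rw [← bessel_integral]
    congr 1; funext θ
    rw [← ee_add, ← ee_add, ← ee_add]; congr 1; ring
  simp only [h3] at h
  rw [h4] at h
  have h5 := h.mul_left ((2 * Real.pi : ℂ)⁻¹)
  rw [inv_mul_cancel_left₀ hpi] at h5
  convert! h5 using 1
  funext p
  field_simp

lemma main_real (k : ℤ) (A z τ : ℝ) :
    HasSum (fun p : ℤ × ℤ => besselJ p.1 z * besselJ p.2 z * besselJ (k - p.1 - p.2) A
        * Real.cos ((p.1 - p.2) * τ)) (besselJ k (A + 2 * z * Real.cos τ)) := by
  have h := Complex.hasSum_re (main_complex k A z τ)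
  rw [Complex.ofReal_re] at h
  convert! h using 1
  funext p
  have h1 : (ee ((p.1 - p.2) * τ)).re = Real.cos ((p.1 - p.2) * τ) := by
    unfold ee; rw [Complex.exp_ofReal_mul_I_re]
  rw [← h1, mul_right_comm (_ * _) (ee _), ← Complex.ofReal_mul, ← Complex.ofReal_mul,
    Complex.re_ofReal_mul]

/-- The `j`-th term of the two-sided coefficient series. -/
noncomputable def sterm (k : ℤ) (A z : ℝ) (l j : ℤ) : ℝ :=
  besselJ (l + j) z * besselJ j z * besselJ (k - l - 2 * j) A

/-- Reindexing of pairs of integers by difference. -/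
def lEquiv : ℤ × ℤ ≃ ℤ × ℤ where
  toFun p := (p.1 + p.2, p.2)
  invFun p := (p.1 - p.2, p.2)
  left_inv := by rintro ⟨n, q⟩; simp
  right_inv := by rintro ⟨n, q⟩; simp

lemma main_l (k : ℤ) (A z τ : ℝ) :
    HasSum (fun p : ℤ × ℤ => sterm k A z p.1 p.2 * Real.cos (p.1 * τ))
      (besselJ k (A + 2 * z * Real.cos τ)) := by
  have h := (lEquiv.hasSum_iff).2 (main_real k A z τ)
  convert! h using 1
  funext p
  simp only [Function.comp, lEquiv, Equiv.coe_fn_mk, sterm]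
  congr 2
  · congr 1; ring
  · congr 1; push_cast; ring

lemma summable_sterm (k : ℤ) (A z : ℝ) (l : ℤ) : Summable (sterm k A z l) := by
  have := (main_l k A z 0).summable.prod_factor l
  simpa using this

lemma main_S (k : ℤ) (A z τ : ℝ) :
    HasSum (fun l : ℤ => (∑' j, sterm k A z l j) * Real.cos (l * τ))
      (besselJ k (A + 2 * z * Real.cos τ)) :=
  (main_l k A z τ).prod_fiberwise fun l => (summable_sterm k A z l).hasSum.mul_right _

lemma S_neg (k : ℤ) (A z : ℝ) (l : ℤ) :
    ∑' j, sterm k A z (-l) j = ∑' j, sterm k A z l j := by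
  rw [← (Equiv.addRight l).tsum_eq (sterm k A z (-l))]
  refine tsum_congr fun j => ?_
  simp only [sterm, Equiv.coe_addRight]
  rw [show -l + (j + l) = j by ring, show k - -l - 2 * (j + l) = k - l - 2 * j by ring,
    show j + l = l + j by ring]
  ring

lemma neg_pair (u v : ℤ) (z : ℝ) :
    besselJ (-u) z * besselJ (-v) z = (-1 : ℝ) ^ (u + v) * (besselJ u z * besselJ v z) := by
  rw [besselJ_neg, besselJ_neg, zpow_add₀ (by norm_num)]; ring

lemma coef (a b r : ℝ) (k l : ℕ) :
    HasSum (fun q : ℕ => cklp a b r k l (if Even l then 2 * q else 2 * q + 1))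
      (2 * ∑' j, sterm k ((b + a) * r / 2) ((b - a) * r / 4) l j) := by
  set A := (b + a) * r / 2 with hA
  set z := (b - a) * r / 4 with hz
  have hS := (summable_sterm k A z l).hasSum
  split_ifs with hl
  · obtain ⟨s, rfl⟩ := hl
    have h1 := ((Equiv.addRight (-(s : ℤ))).hasSum_iff).2 hS
    have h2 := (h1.nat_add_neg.sub (hasSum_ite_eq (0 : ℕ)
      ((sterm k A z (s + s : ℕ) ∘ Equiv.addRight (-(s : ℤ))) 0))).mul_left 2
    rw [add_sub_cancel_right] at h2
    convert! h2 using 1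
    funext q
    simp only [Function.comp, Equiv.coe_addRight, sterm, cklp, ← hA, ← hz]
    have e1 : ((2 * q : ℕ) + ((s + s : ℕ) : ℤ)) / 2 = q + s := by push_cast; omega
    have e2 : ((2 * q : ℕ) - ((s + s : ℕ) : ℤ)) / 2 = q - s := by push_cast; omega
    have e3 : ((s + s : ℕ) : ℤ) + (q + -s) = q + s := by push_cast; ring
    have e4 : ((s + s : ℕ) : ℤ) + (-q + -s) = -(q - s) := by push_cast; ring
    have e5 : (q : ℤ) + -s = q - s := by ring
    have e6 : -(q : ℤ) + -s = -(q + s) := by ring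
    have e7 : (k : ℤ) - (s + s : ℕ) - 2 * (q - s) = k - (2 * q : ℕ) := by push_cast; ring
    have e8 : (k : ℤ) - (s + s : ℕ) - 2 * -(q + s) = k + (2 * q : ℕ) := by push_cast; ring
    have e9 : (-1 : ℝ) ^ (((q : ℤ) - s) + (q + s)) = 1 := Even.neg_one_zpow ⟨q, by ring⟩
    rw [e1, e2, e3, e4, e5, e6, e7, e8, neg_pair, e9, pow_mul]
    by_cases hq : q = 0
    · subst hq
      have e10 : ((s + s : ℕ) : ℤ) + (0 + -s) = (0 : ℕ) + s := by push_cast; ring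
      have e11 : (0 : ℤ) + -s = (0 : ℕ) - s := by push_cast; ring
      rw [e10, e11, e7]
      simp
      ring
    · simp [hq]; ring
  · obtain ⟨s, rfl⟩ := Nat.not_even_iff_odd.1 hl
    have h1 := ((Equiv.addRight (-(s : ℤ))).hasSum_iff).2 hS
    have h2 := (h1.nat_add_neg_add_one).mul_left 2
    convert! h2 using 1
    funext q
    simp only [Function.comp, Equiv.coe_addRight, sterm, cklp, ← hA, ← hz]
    have e1 : ((2 * q + 1 : ℕ) + ((2 * s + 1 : ℕ) : ℤ)) / 2 = q + s + 1 := by push_cast; omega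
    have e2 : ((2 * q + 1 : ℕ) - ((2 * s + 1 : ℕ) : ℤ)) / 2 = q - s := by push_cast; omega
    have e3 : ((2 * s + 1 : ℕ) : ℤ) + (q + -s) = q + s + 1 := by push_cast; ring
    have e4 : ((2 * s + 1 : ℕ) : ℤ) + (-(q + 1) + -s) = -(q - s) := by push_cast; ring
    have e5 : (q : ℤ) + -s = q - s := by ring
    have e6 : -((q : ℤ) + 1) + -s = -(q + s + 1) := by ring
    have e7 : (k : ℤ) - (2 * s + 1 : ℕ) - 2 * (q - s) = k - (2 * q + 1 : ℕ) := by
      push_cast; ring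
    have e8 : (k : ℤ) - (2 * s + 1 : ℕ) - 2 * -(q + s + 1) = k + (2 * q + 1 : ℕ) := by
      push_cast; ring
    have e9 : (-1 : ℝ) ^ (((q : ℤ) - s) + (q + s + 1)) = -1 :=
      Odd.neg_one_zpow ⟨q, by ring⟩
    have e10 : (-1 : ℝ) ^ (2 * q + 1) = -1 := Odd.neg_one_pow ⟨q, rfl⟩
    rw [e1, e2, e3, e4, e5, e6, e7, e8, neg_pair, e9, e10, if_neg (by omega)]
    ring

theorem stmt7 (k : ℕ) (a b r ρ : ℝ) (ha : 0 ≤ a) (hab : a < b) (hr : 0 < r)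
    (hρ : ρ ∈ Set.Icc a b) :
    (∀ ℓ : ℕ, Summable (fun q : ℕ => cklp a b r k ℓ (if Even ℓ then 2 * q else 2 * q + 1))) ∧
    HasSum
      (fun ℓ : ℕ => ckl a b r k (ℓ + 1) *
        (Polynomial.Chebyshev.T ℝ ((ℓ : ℤ) + 1)).eval (2 * (ρ - a) / (b - a) - 1))
      (besselJ (k : ℤ) (ρ * r) - ckl a b r k 0 / 2) := by
  refine ⟨fun l => (coef a b r k l).summable, ?_⟩
  have hba : 0 < b - a := sub_pos.2 hab
  set y := 2 * (ρ - a) / (b - a) - 1 with hy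
  have hy1 : -1 ≤ y := by
    have : 0 ≤ 2 * (ρ - a) / (b - a) := div_nonneg (by linarith [hρ.1]) hba.le
    linarith
  have hy2 : y ≤ 1 := by
    have : 2 * (ρ - a) / (b - a) ≤ 2 := by
      rw [div_le_iff₀ hba]; linarith [hρ.2]
    linarith
  have hcos : Real.cos (Real.arccos y) = y := Real.cos_arccos hy1 hy2
  set τ := Real.arccos y with hτ
  have hc : ∀ l : ℕ, ckl a b r k l =
      2 * ∑' j, sterm k ((b + a) * r / 2) ((b - a) * r / 4) l j :=
    fun l => (coef a b r k l).tsum_eq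
  have hm := main_S k ((b + a) * r / 2) ((b - a) * r / 4) τ
  have harg : (b + a) * r / 2 + 2 * ((b - a) * r / 4) * Real.cos τ = ρ * r := by
    rw [hcos, hy]; field_simp; ring
  rw [harg] at hm
  have h2 := (hasSum_nat_add_iff' 1).2 hm.nat_add_neg
  convert! h2 using 1
  · funext l
    have hT : (Polynomial.Chebyshev.T ℝ ((l : ℤ) + 1)).eval y = Real.cos (((l : ℤ) + 1 : ℤ) * τ) := by
      rw [← Polynomial.Chebyshev.T_real_cos, hcos]
    rw [hc, hT, S_neg]
    push_cast
    rw [neg_mul, Real.cos_neg]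
    ring
  · rw [hc]
    simp
end

section
/- (Decay of even Chebyshev coefficients of the Bessel kernel.) Let k be a nonnegative integer, let ℓ be an even nonnegative integer, let 0 ≤ a < b and r > 0 be reals, and let ξ be a real number with ξ > (b−a)r/8. Then |c_{kℓ}(r)| ≤ 4 e^ξ · ( (b−a)r/(8ξ) )^{ℓ/2} / ( 1 − (b−a)r/(8ξ) ). -/
/-- The Chebyshev coefficient `c_{kℓ}(r)` of the Bessel function `J_k(ρ r)` for
`ρ ∈ [a, b]`, in its integral form. -/
noncomputable def chebCoef (a b r : ℝ) (k : ℤ) (ℓ : ℕ) : ℝ :=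
  2 / Real.pi * ∫ τ in (0 : ℝ)..Real.pi,
    besselJ k ((b - a) * r / 2 * Real.cos τ + (b + a) * r / 2) * Real.cos (ℓ * τ)

open Complex intervalIntegral

lemma aux_exp_int (n : ℤ) : (∫ θ in (0:ℝ)..(2*Real.pi), Complex.exp ((n * I) * θ)) =
    if n = 0 then (2 * Real.pi : ℂ) else 0 := by
  split_ifs with h
  · simp [h]
  · have : (n * I : ℂ) ≠ 0 := by simp [h]
    rw [integral_exp_mul_complex this]
    have h2 : Complex.exp (n * I * ((2 * Real.pi : ℝ) : ℂ)) = 1 := by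
      rw [Complex.exp_eq_one_iff]; exact ⟨n, by push_cast; ring⟩
    rw [h2]; simp

lemma inner_bound (ℓ : ℕ) (s y : ℝ) (hs : 0 < s) (hs1 : s < 1) :
    ‖∫ τ in (0:ℝ)..Real.pi, Complex.exp (I * y * Real.cos τ) * (Real.cos (ℓ * τ) : ℂ)‖ ≤
      Real.pi * (s ^ ℓ * Real.exp (|y| / 2 * (1 / s - s))) := by
  set F : ℂ → ℂ := fun z => z ^ ℓ * Complex.exp (I * y / 2 * (z + z⁻¹)) with hF
  have key := Complex.circleIntegral_sub_center_inv_smul_eq_of_differentiable_on_annulus_off_countable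
    (c := 0) hs hs1.le (f := F) (s := ∅) Set.countable_empty
    (by
      intro z hz
      have : z ≠ 0 := by
        rintro rfl
        simp [hs] at hz
      exact ContinuousAt.continuousWithinAt (by fun_prop (disch := assumption)))
    (by
      intro z hz
      have : z ≠ 0 := by
        rintro rfl
        simp [hs.le] at hz
      fun_prop (disch := assumption))
  have hR : ∀ R : ℝ, 0 < R → (∮ z in C(0, R), (z - 0)⁻¹ • F z) =
      I * ∫ θ in (0:ℝ)..(2*Real.pi), F (circleMap 0 R θ) := by
    intro R hR
    rw [circleIntegral, ← intervalIntegral.integral_const_mul]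
    congr 1
    ext θ
    have : circleMap 0 R θ ≠ 0 := circleMap_ne_center hR.ne'
    simp only [deriv_circleMap, sub_zero, smul_eq_mul]
    field_simp
  rw [hR 1 one_pos, hR s hs] at key
  have key2 := mul_left_cancel₀ I_ne_zero key
  have hG : ∀ θ : ℝ, F (circleMap 0 1 θ) = Complex.exp (I * y * Real.cos θ) * Complex.exp (ℓ * θ * I) := by
    intro θ
    simp only [hF, circleMap, ofReal_one, one_mul, zero_add]
    rw [← Complex.exp_neg, ← Complex.exp_nat_mul, mul_comm]
    congr 2
    · rw [Complex.ofReal_cos, Complex.cos, neg_mul]; ring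
    · ring
  have hcont : Continuous (fun θ : ℝ => Complex.exp (I * y * Real.cos θ) * Complex.exp (ℓ * θ * I)) := by fun_prop
  have h2 : (∫ θ in (0:ℝ)..(2*Real.pi), F (circleMap 0 1 θ)) =
     2 * ∫ τ in (0:ℝ)..Real.pi, Complex.exp (I * y * Real.cos τ) * (Real.cos (ℓ * τ) : ℂ) := by
    simp_rw [hG]
    have hper : Function.Periodic (fun θ : ℝ => Complex.exp (I * y * Real.cos θ) * Complex.exp (ℓ * θ * I)) (2 * Real.pi) := by
      intro θ
      simp only [Real.cos_add_two_pi]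
      congr 1
      rw [Complex.exp_eq_exp_iff_exists_int]
      exact ⟨ℓ, by push_cast; ring⟩
    have h3 := hper.intervalIntegral_add_eq 0 (-Real.pi)
    rw [show (0:ℝ) + 2 * Real.pi = 2 * Real.pi by ring, show -Real.pi + 2 * Real.pi = Real.pi by ring] at h3
    rw [h3, ← integral_add_adjacent_intervals (b := 0) (hcont.intervalIntegrable _ _) (hcont.intervalIntegrable _ _)]
    have h4 := intervalIntegral.integral_comp_neg (a := 0) (b := Real.pi) (fun θ : ℝ => Complex.exp (I * y * Real.cos θ) * Complex.exp (ℓ * θ * I))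
    rw [neg_zero] at h4
    rw [← h4, ← integral_add, ← intervalIntegral.integral_const_mul]
    · congr 1
      ext θ
      rw [Real.cos_neg, Complex.ofReal_cos (ℓ * θ), Complex.cos]
      push_cast
      ring_nf
    · exact (hcont.comp continuous_neg).intervalIntegrable _ _
    · exact hcont.intervalIntegrable _ _
  have h5 : ‖∫ θ in (0:ℝ)..(2*Real.pi), F (circleMap 0 s θ)‖ ≤ (s ^ ℓ * Real.exp (|y| / 2 * (1 / s - s))) * |2 * Real.pi - 0| := by
    apply intervalIntegral.norm_integral_le_of_norm_le_const
    intro θ _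
    simp only [hF, norm_mul, norm_pow, norm_circleMap_zero, abs_of_pos hs, Complex.norm_exp]
    gcongr
    have : (I * y / 2 * (circleMap 0 s θ + (circleMap 0 s θ)⁻¹)) =
       I * y / 2 * (s * (Real.cos θ + Real.sin θ * I) + (1/s) * (Real.cos θ - Real.sin θ * I)) := by
      simp only [circleMap, zero_add, mul_inv, ← Complex.exp_neg]
      rw [Complex.exp_mul_I, ← neg_mul, Complex.exp_mul_I, Complex.cos_neg, Complex.sin_neg]
      push_cast
      ring
    rw [this]
    have h6 : (I * y / 2 * (s * (Real.cos θ + Real.sin θ * I) + (1/s) * (Real.cos θ - Real.sin θ * I)) : ℂ)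
      = ((y / 2 * (1 / s - s) * Real.sin θ : ℝ) : ℂ) + ((y/2 * (s + 1/s) * Real.cos θ : ℝ) : ℂ) * I := by
      push_cast
      linear_combination (y / 2 * (s - 1/s) * Complex.sin θ : ℂ) * I_mul_I
    rw [h6]
    rw [Complex.add_re, Complex.ofReal_re, Complex.re_ofReal_mul, Complex.I_re, mul_zero, add_zero]
    have h7 : 0 ≤ 1 / s - s := by
      rw [sub_nonneg, le_div_iff₀ hs]; nlinarith
    calc _ ≤ |y / 2 * (1 / s - s) * Real.sin θ| := le_abs_self _
      _ = |y| / 2 * (1 / s - s) * |Real.sin θ| := by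
        rw [abs_mul, abs_mul, abs_of_nonneg h7, abs_div, abs_two]
      _ ≤ _ := mul_le_of_le_one_right (mul_nonneg (by positivity) h7) (Real.abs_sin_le_one θ)
  rw [← key2, h2, norm_mul, sub_zero, abs_of_pos (show (0:ℝ) < 2 * Real.pi by positivity), Complex.norm_two] at h5
  linarith


lemma prod_hasSum {f g : ℕ → ℂ} {A B : ℂ} (e1 : HasSum f A) (e2 : HasSum g B) :
    HasSum (fun p : ℕ × ℕ => f p.1 * g p.2) (A * B) := by
  have h3 : Summable (fun p : ℕ × ℕ => f p.1 * g p.2) :=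
    summable_mul_of_summable_norm e1.summable.norm e2.summable.norm
  exact HasSum.mul e1 e2 h3

lemma exp_hasSum (u : ℂ) :
    HasSum (fun n : ℕ => u ^ n / (n.factorial : ℂ)) (Complex.exp u) := by
  rw [Complex.exp_eq_exp_ℂ]
  exact NormedSpace.expSeries_div_hasSum_exp u

lemma exp_prod_hasSum (u v : ℂ) : HasSum (fun p : ℕ × ℕ =>
    (u ^ p.1 / (p.1.factorial : ℂ)) * (v ^ p.2 / (p.2.factorial : ℂ))) (Complex.exp (u + v)) := by
  rw [Complex.exp_add]
  have h := prod_hasSum (f := fun n : ℕ => u ^ n / (n.factorial : ℂ))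
    (g := fun n : ℕ => v ^ n / (n.factorial : ℂ)) (exp_hasSum u) (exp_hasSum v)
  exact h

lemma bessel_rep (k : ℕ) (x : ℝ) : (∫ θ in (0:ℝ)..(2*Real.pi),
    Complex.exp (I * x * Real.sin θ) * Complex.exp (-(k * θ * I))) =
      2 * Real.pi * (besselJNat k x : ℂ) := by
  let g : ℝ → ℕ → ℂ := fun y n => (y / 2 : ℂ) ^ n / (n.factorial : ℂ)
  have hg : ∀ y : ℝ, Summable (fun n => ‖g y n‖) := fun y => by
    have := (NormedSpace.expSeries_div_summable (y / 2 : ℂ)).norm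
    exact this
  let c : ℕ × ℕ → ℂ := fun p => g x p.1 * g (-x) p.2
  have hc : Summable (fun p => ‖c p‖) := (hg x).mul_norm (hg (-x))
  let f : ℕ × ℕ → ℝ → ℂ := fun p θ =>
    c p * Complex.exp ((((p.1 : ℤ) - p.2 - k : ℤ) * I) * θ)
  have hE : ∀ (n : ℤ) (θ : ℝ), ‖Complex.exp ((n * I) * θ)‖ = 1 := by
    intro n θ
    rw [Complex.norm_exp]; simp
  have hs : HasSum (fun p => ∫ θ in (0:ℝ)..(2*Real.pi), f p θ) (∫ θ in (0:ℝ)..(2*Real.pi),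
    Complex.exp (I * x * Real.sin θ) * Complex.exp (-(k * θ * I))) := by
    apply intervalIntegral.hasSum_integral_of_dominated_convergence (fun p _ => ‖c p‖)
    · intro p
      exact Continuous.aestronglyMeasurable (by fun_prop)
    · intro p
      refine Filter.Eventually.of_forall fun θ _ => ?_
      simp only [f]
      rw [norm_mul, hE, mul_one]
    · exact Filter.Eventually.of_forall fun θ _ => hc
    · exact intervalIntegrable_const
    · refine Filter.Eventually.of_forall fun θ _ => ?_
      have e3 := (exp_prod_hasSum ((x / 2 : ℂ) * Complex.exp (θ * I))
        (((-x : ℝ) / 2 : ℂ) * Complex.exp (-(θ * I)))).mul_right (Complex.exp (-(k * θ * I)))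
      have E1 : ∀ p, f p θ = ((x / 2 : ℂ) * Complex.exp (θ * I)) ^ p.1 / (p.1.factorial : ℂ) *
          ((((-x : ℝ) / 2 : ℂ) * Complex.exp (-(θ * I))) ^ p.2 / (p.2.factorial : ℂ)) *
            Complex.exp (-(k * θ * I)) := by
        intro p
        simp only [f, c, g, mul_pow, ← Complex.exp_nat_mul]
        rw [show ((((p.1 : ℤ) - p.2 - k : ℤ) * I) * θ : ℂ) =
          p.1 * (θ * I) + p.2 * (-(θ * I)) + -(k * θ * I) by
          push_cast; ring, Complex.exp_add, Complex.exp_add]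
        ring
      have E2 : (I * x * Real.sin θ : ℂ) = (x / 2 : ℂ) * Complex.exp (θ * I) +
          ((-x : ℝ) / 2 : ℂ) * Complex.exp (-(θ * I)) := by
        rw [Complex.ofReal_sin, Complex.sin, neg_mul]
        push_cast
        linear_combination (x / 2 : ℂ) * (Complex.exp (-(θ * I)) - Complex.exp (θ * I)) * I_mul_I
      rw [E2]
      simp_rw [E1]
      exact e3
  have hf : ∀ p, (∫ θ in (0:ℝ)..(2*Real.pi), f p θ) =
      if (p.1 : ℤ) - p.2 - k = 0 then c p * (2 * Real.pi) else 0 := by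
    intro p
    simp only [f]
    rw [intervalIntegral.integral_const_mul, aux_exp_int]
    split_ifs <;> simp
  simp_rw [hf] at hs
  let i : ℕ → ℕ × ℕ := fun q => (q + k, q)
  have hi : Function.Injective i := fun q q' h => by simpa [i] using congrArg Prod.snd h
  have hs2 := (hi.hasSum_iff (f := fun p : ℕ × ℕ => if (p.1 : ℤ) - p.2 - k = 0 then c p * (2 * Real.pi : ℂ) else 0) (by
    rintro ⟨j, q⟩ hp
    apply if_neg
    intro h
    apply hp
    exact ⟨q, by simp only [i, Prod.mk.injEq, and_true]; simp only at h; omega⟩)).2 hs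
  rw [← hs2.tsum_eq, besselJNat, Complex.ofReal_tsum, ← tsum_mul_left]
  congr 1
  ext q
  simp only [Function.comp, i, c, g]
  rw [if_pos (by push_cast; ring)]
  push_cast
  rw [show (-(x:ℂ) / 2) = (-1) * (x / 2) by ring, mul_pow (-1 : ℂ)]
  field_simp
  ring

theorem stmt11 (k ℓ : ℕ) (hℓ : Even ℓ) (a b r ξ : ℝ) (ha : 0 ≤ a) (hab : a < b)
    (hr : 0 < r) (hξ : (b - a) * r / 8 < ξ) :
    |chebCoef a b r (k : ℤ) ℓ| ≤
      4 * Real.exp ξ * ((b - a) * r / (8 * ξ)) ^ (ℓ / 2) /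
        (1 - (b - a) * r / (8 * ξ)) := by
  have hba : 0 < (b - a) * r := mul_pos (sub_pos.2 hab) hr
  have hξ0 : 0 < ξ := by linarith
  set w := (b - a) * r / (8 * ξ) with hw
  have hw0 : 0 < w := by positivity
  have hw1 : w < 1 := by rw [hw, div_lt_one (by positivity)]; linarith
  set h := (b - a) * r / 2 with hh
  set m := (b + a) * r / 2 with hm
  have hhw : h = 4 * ξ * w := by rw [hh, hw]; field_simp; ring
  obtain ⟨s, hs0, hsw⟩ : ∃ s : ℝ, 0 < s ∧ s ^ 2 = w := ⟨√w, Real.sqrt_pos.2 hw0, Real.sq_sqrt hw0.le⟩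
  have hs1 : s < 1 := by nlinarith
  set B := w ^ (ℓ / 2) * Real.exp ξ with hB
  have hB0 : 0 < B := by positivity
  have hpi := Real.pi_pos
  have hin : ∀ θ : ℝ, ‖∫ τ in (0:ℝ)..Real.pi,
      Complex.exp (I * (h * Real.sin θ : ℝ) * Real.cos τ) * (Real.cos (ℓ * τ) : ℂ)‖ ≤ Real.pi * B := by
    intro θ
    refine (inner_bound ℓ s (h * Real.sin θ) hs0 hs1).trans ?_
    have e1 : s ^ ℓ = w ^ (ℓ / 2) := by
      rw [← hsw, ← pow_mul, Nat.mul_div_cancel' hℓ.two_dvd]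
    rw [e1, hB]
    gcongr
    have h7 : 0 ≤ 1 / s - s := by
      rw [sub_nonneg, le_div_iff₀ hs0]; nlinarith
    have hh0 : 0 < h := by positivity
    have h8 : |h * Real.sin θ| ≤ h := by
      rw [abs_mul, abs_of_pos hh0]
      exact mul_le_of_le_one_right hh0.le (Real.abs_sin_le_one θ)
    calc _ ≤ h / 2 * (1 / s - s) := by gcongr
      _ = ξ * (2 * s * (1 - s ^ 2)) := by rw [hhw, ← hsw]; field_simp; ring
      _ ≤ ξ * 1 := by
        gcongr
        nlinarith [mul_nonneg hs0.le (sq_nonneg (s - 1/2)), sq_nonneg (s - 1/2), sq_nonneg (s-2/3), sq_nonneg (s-3/5)]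
      _ = ξ := mul_one _
  have hmain : (2 * Real.pi : ℂ) * ((∫ τ in (0 : ℝ)..Real.pi,
      besselJ k (h * Real.cos τ + m) * Real.cos (ℓ * τ) : ℝ) : ℂ) =
      ∫ θ in (0:ℝ)..(2*Real.pi), Complex.exp (I * m * Real.sin θ) * Complex.exp (-(k * θ * I)) *
        ∫ τ in (0:ℝ)..Real.pi,
      Complex.exp (I * (h * Real.sin θ : ℝ) * Real.cos τ) * (Real.cos (ℓ * τ) : ℂ) := by
    rw [← intervalIntegral.integral_ofReal, ← intervalIntegral.integral_const_mul]
    simp_rw [← intervalIntegral.integral_const_mul]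
    rw [MeasureTheory.intervalIntegral_intervalIntegral_swap]
    · congr 1
      ext τ
      have : besselJ k (h * Real.cos τ + m) = besselJNat k (h * Real.cos τ + m) := by simp [besselJ]
      rw [this, Complex.ofReal_mul, ← mul_assoc, ← bessel_rep, ← intervalIntegral.integral_mul_const]
      congr 1
      ext θ
      rw [show (I * ((h * Real.cos τ + m : ℝ) : ℂ) * (Real.sin θ : ℂ)) = I * m * Real.sin θ +
        I * (h * Real.sin θ : ℝ) * Real.cos τ by push_cast; ring, Complex.exp_add]
      ring
    · refine MeasureTheory.IntegrableOn.mono_set (t := Set.uIcc 0 (2 * Real.pi) ×ˢ Set.uIcc 0 Real.pi) ?_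
        (Set.prod_mono Set.uIoc_subset_uIcc Set.uIoc_subset_uIcc)
      apply ContinuousOn.integrableOn_compact (isCompact_uIcc.prod isCompact_uIcc)
      apply Continuous.continuousOn
      unfold Function.uncurry
      fun_prop
  have hb : ‖(2 * Real.pi : ℂ) * ((∫ τ in (0 : ℝ)..Real.pi,
      besselJ k (h * Real.cos τ + m) * Real.cos (ℓ * τ) : ℝ) : ℂ)‖ ≤ (Real.pi * B) * |2 * Real.pi - 0| := by
    rw [hmain]
    apply intervalIntegral.norm_integral_le_of_norm_le_const
    intro θ _
    rw [norm_mul, norm_mul, Complex.norm_exp, Complex.norm_exp]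
    have z1 : (I * m * Real.sin θ : ℂ).re = 0 := by
      rw [show (I * m * Real.sin θ : ℂ) = ((m * Real.sin θ : ℝ) : ℂ) * I by push_cast; ring]
      exact (Complex.re_ofReal_mul _ _).trans (by simp)
    have z2 : (-(k * θ * I) : ℂ).re = 0 := by simp
    rw [z1, z2, Real.exp_zero, one_mul, one_mul]
    exact hin θ
  rw [norm_mul, norm_mul, Complex.norm_two, Complex.norm_real, Complex.norm_real, Real.norm_eq_abs,
    Real.norm_eq_abs, sub_zero, abs_of_pos hpi, abs_of_pos (show (0:ℝ) < 2 * Real.pi by positivity), mul_comm] at hb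
  have hb2 := le_of_mul_le_mul_right hb (by positivity)
  have hfin : |chebCoef a b r (k : ℤ) ℓ| ≤ 2 * B := by
    rw [chebCoef, abs_mul, abs_of_pos (by positivity)]
    calc _ ≤ 2 / Real.pi * (Real.pi * B) := by gcongr
      _ = 2 * B := by field_simp
  refine hfin.trans ?_
  rw [le_div_iff₀ (by linarith)]
  nlinarith [mul_pos hB0 hw0]
end
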